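/- There exists a universal constant c > 0 such that for all n ≥ 1, all ε with 1/n ≤ ε ≤ 1/2, and every nonempty subset A ⊆ L_mid: E_{x uniform in A}[score↓(x,A)] ≥ 1 + c·ε⁴·E_{x uniform in A}[score↑(x,A)]. -/

import Mathlib

open Finset

/-- The Hamming weight `‖x‖₁` of `x ∈ {0,1}^n`. -/
def wt {n : ℕ} (x : Fin n → Bool) : ℕ :=
  (Finset.univ.filter (fun i => x i = true)).card

/-- The Hamming distance `‖x − y‖₁`. -/
def hamm {n : ℕ} (x y : Fin n → Bool) : ℕ :=
  (Finset.univ.filter (fun i => x i ≠ y i)).card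

/-- The parameter `d = d(n,ε) = 2⌈√(2n·ln(100/ε))⌉`. -/
noncomputable def dPar (n : ℕ) (ε : ℝ) : ℕ :=
  2 * ⌈Real.sqrt (2 * n * Real.log (100 / ε))⌉₊

open Classical in
/-- The middle layers `L_mid = {x : (n−d)/2 ≤ ‖x‖₁ ≤ (n+d)/2}`. -/
noncomputable def Lmid (n : ℕ) (ε : ℝ) : Finset (Fin n → Bool) :=
  Finset.univ.filter (fun x =>
    ((n : ℝ) - dPar n ε) / 2 ≤ (wt x : ℝ) ∧ (wt x : ℝ) ≤ ((n : ℝ) + dPar n ε) / 2)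

/-- The `j`-th point (from the bottom) of the path from `0^n` to `1^n` determined by the
permutation `π`: its ones are exactly in positions `π(0),…,π(j−1)`. -/
def pathPoint {n : ℕ} (π : Equiv.Perm (Fin n)) (j : ℕ) : Fin n → Bool :=
  fun i => decide ((π.symm i : ℕ) < j)

/-- The indices `j` of the points of the path `π` lying in the middle layers `L_mid`. -/
noncomputable def pmidIdx (n : ℕ) (ε : ℝ) (π : Equiv.Perm (Fin n)) : Finset ℕ :=
  (Finset.range (n + 1)).filter (fun j => pathPoint π j ∈ Lmid n ε)

open Classical in
/-- `dens↓_k(x,A)`: the probability that a uniformly random `y ≼ x` with `‖x−y‖₁ = k`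
lies in `A` (if `k ≤ ‖x‖₁`, and `0` otherwise). -/
noncomputable def densDown {n : ℕ} (x : Fin n → Bool) (A : Finset (Fin n → Bool)) (k : ℕ) : ℝ :=
  if k ≤ wt x then
    ((A.filter (fun y => (∀ i, y i ≤ x i) ∧ hamm y x = k)).card : ℝ) / ((wt x).choose k : ℝ)
  else 0

open Classical in
/-- `dens↑_k(x,A)`: the probability that a uniformly random `y ≽ x` with `‖y−x‖₁ = k`
lies in `A` (if `k ≤ n − ‖x‖₁`, and `0` otherwise). -/
noncomputable def densUp {n : ℕ} (x : Fin n → Bool) (A : Finset (Fin n → Bool)) (k : ℕ) : ℝ :=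
  if k ≤ n - wt x then
    ((A.filter (fun y => (∀ i, x i ≤ y i) ∧ hamm x y = k)).card : ℝ) / ((n - wt x).choose k : ℝ)
  else 0

/-- `score↓(x,A) = Σ_{k=0}^n dens↓_k(x,A)`. -/
noncomputable def scoreDown {n : ℕ} (x : Fin n → Bool) (A : Finset (Fin n → Bool)) : ℝ :=
  ∑ k ∈ Finset.range (n + 1), densDown x A k

/-- `score↑(x,A) = Σ_{k=1}^n dens↑_k(x,A)`. -/
noncomputable def scoreUp {n : ℕ} (x : Fin n → Bool) (A : Finset (Fin n → Bool)) : ℝ :=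
  ∑ k ∈ Finset.Icc 1 n, densUp x A k

lemma choose_mono_half (n a b : ℕ) (hab : a ≤ b) (hb : b ≤ n / 2) :
    n.choose a ≤ n.choose b := by
  induction b, hab using Nat.le_induction with
  | base => exact le_rfl
  | succ k hk ih =>
    exact (ih (by omega)).trans (Nat.choose_le_succ_of_lt_half_left (by omega))

lemma choose_decay (n S : ℕ) (hS : S < n / 2) (s : ℕ) (hs : s ≤ S) :
    (n.choose (n / 2) : ℝ) * Real.exp (-((s : ℝ) ^ 2 / (((n / 2 : ℕ) : ℝ) - S))) ≤
      (n.choose (n / 2 + s) : ℝ) := by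
  induction s with
  | zero => simp
  | succ s ih =>
    have ih := ih (by omega)
    have h2m : 2 * (n / 2) ≤ n := Nat.mul_div_le n 2
    generalize hm : n / 2 = m at *
    have hrec : (n.choose (m + s + 1) : ℝ) * (m + s + 1) = n.choose (m + s) * (n - (m + s)) := by
      have := Nat.choose_succ_right_eq n (m + s)
      have h3 : m + s ≤ n := by omega
      have h4 : ((n.choose (m + s + 1) * (m + s + 1) : ℕ) : ℝ)
        = ((n.choose (m + s) * (n - (m + s)) : ℕ) : ℝ) := by exact_mod_cast this
      push_cast [Nat.cast_sub h3] at h4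
      linarith
    have hSm : (S : ℝ) < m := by exact_mod_cast hS
    have hsS : (s : ℝ) + 1 ≤ S := by exact_mod_cast hs
    have hnm : 2 * (m : ℝ) ≤ n := by exact_mod_cast h2m
    have hs0 : (0 : ℝ) ≤ s := Nat.cast_nonneg s
    have hm0 : (0 : ℝ) < (m : ℝ) - S := by linarith
    set q : ℝ := (2 * s + 1) / ((m : ℝ) - S) with hq
    have hq0 : 0 ≤ q := by positivity
    have hqm : q * ((m : ℝ) - S) = 2 * s + 1 := by rw [hq]; field_simp
    have hexp : Real.exp (-(((s + 1 : ℕ) : ℝ) ^ 2 / ((m : ℝ) - S))) =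
        Real.exp (-((s : ℝ) ^ 2 / ((m : ℝ) - S))) * Real.exp (-q) := by
      rw [← Real.exp_add]; congr 1; rw [hq]; push_cast; field_simp; ring
    have hE : 1 + q ≤ Real.exp q := by linarith [Real.add_one_le_exp q]
    have hE1 : Real.exp q * Real.exp (-q) = 1 := by rw [← Real.exp_add]; simp
    have hEp : 0 < Real.exp (-q) := Real.exp_pos _
    have hkey : Real.exp (-q) * (m + s + 1) ≤ (n : ℝ) - (m + s) := by
      have h1 : (m : ℝ) + s + 1 ≤ (1 + q) * (m - s) := by nlinarith
      have h2 : (1 + q) * Real.exp (-q) ≤ 1 := by nlinarith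
      have h3 : (0 : ℝ) ≤ m - s := by linarith
      nlinarith
    rw [hexp, ← add_assoc]
    have hpos : (0 : ℝ) < m + s + 1 := by positivity
    have hC : (0 : ℝ) ≤ n.choose (m + s) := Nat.cast_nonneg _
    refine le_of_mul_le_mul_right ?_ hpos
    rw [hrec]
    calc _ = (n.choose m * Real.exp (-((s : ℝ) ^ 2 / ((m : ℝ) - S))))
            * (Real.exp (-q) * (m + s + 1)) := by ring
      _ ≤ n.choose (m + s) * ((n : ℝ) - (m + s)) := by
        apply mul_le_mul ih hkey (by positivity) hC

lemma log_cube (n ε : ℝ) (hn : 1 ≤ n) (h1 : 1 / n ≤ ε) (h2 : ε ≤ 1 / 2) :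
    0 ≤ Real.log (100 / ε) ∧ Real.log (100 / ε) ^ 3 ≤ 2700 * n := by
  have hε : 0 < ε := lt_of_lt_of_le (by positivity) h1
  have h0 : 0 ≤ Real.log (100 / ε) := by
    apply Real.log_nonneg
    rw [le_div_iff₀ hε]; linarith
  refine ⟨h0, ?_⟩
  have hle : 100 / ε ≤ 100 * n := by
    rw [div_le_iff₀ hε]
    have : 1 ≤ ε * n := by rwa [div_le_iff₀ (by linarith)] at h1
    nlinarith
  have := Real.add_one_le_exp (Real.log (100 / ε) / 3)
  have h3 : Real.log (100 / ε) / 3 ≤ Real.exp (Real.log (100 / ε) / 3) := by linarith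
  have h4 : (Real.log (100 / ε) / 3) ^ 3 ≤ Real.exp (Real.log (100 / ε) / 3) ^ 3 :=
    pow_le_pow_left₀ (by positivity) h3 3
  rw [← Real.exp_nat_mul] at h4
  have h5 : ((3 : ℕ) : ℝ) * (Real.log (100 / ε) / 3) = Real.log (100 / ε) := by push_cast; ring
  rw [h5, Real.exp_log (by positivity)] at h4
  nlinarith

lemma big_case (n : ℕ) (hn : 100000 ≤ n) (ε : ℝ) (h1 : 1 / (n : ℝ) ≤ ε) (h2 : ε ≤ 1 / 2)
    (s : ℕ) (hs : ((n / 2 + s : ℕ) : ℝ) ≤ ((n : ℝ) + dPar n ε) / 2) :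
    Real.exp (-1200) / 100 ^ 4 * ε ^ 4 * (n.choose (n / 2) : ℝ) ≤ n.choose (n / 2 + s) := by
  have hnR : (100000 : ℝ) ≤ n := by exact_mod_cast hn
  have hε : 0 < ε := lt_of_lt_of_le (by positivity) h1
  obtain ⟨hL0, hL3⟩ := log_cube n ε (by linarith) h1 h2
  have hdP : (dPar n ε : ℝ) ≤ 2 * (Real.sqrt (2 * n * Real.log (100 / ε)) + 1) := by
    unfold dPar
    push_cast
    have := Nat.ceil_lt_add_one (Real.sqrt_nonneg (2 * n * Real.log (100 / ε)))
    linarith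
  have hexpL : Real.exp (-(4 * Real.log (100 / ε))) = (ε / 100) ^ 4 := by
    rw [Real.exp_neg, mul_comm, Real.exp_mul, Real.exp_log (by positivity)]
    norm_cast
    rw [← inv_pow, inv_div]
  set L := Real.log (100 / ε) with hL
  set u := Real.sqrt (2 * n * L) with hu
  have hu0 : 0 ≤ u := Real.sqrt_nonneg _
  have hu2 : u ^ 2 = 2 * n * L := Real.sq_sqrt (by positivity)
  have hLn : L ≤ n / 128 := by
    have h : L ^ 3 ≤ ((n : ℝ) / 128) ^ 3 := by
      refine hL3.trans ?_
      have : (100000 : ℝ) ^ 2 ≤ n ^ 2 := by gcongr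
      nlinarith
    exact le_of_pow_le_pow_left₀ (by norm_num) (by positivity) h
  have hun : u ≤ n / 8 := by
    apply le_of_pow_le_pow_left₀ (n := 2) (by norm_num) (by positivity)
    rw [hu2]; nlinarith
  have hLu : L * u ≤ 74 * n := by
    apply le_of_pow_le_pow_left₀ (n := 2) (by norm_num) (by positivity)
    rw [mul_pow, hu2]; nlinarith
  have hm1 : (n : ℝ) ≤ 2 * ((n / 2 : ℕ) : ℝ) + 1 := by
    have : n ≤ 2 * (n / 2) + 1 := by omega
    exact_mod_cast this
  push_cast at hs
  have hs' : ((n / 2 : ℕ) : ℝ) + s ≤ ((n : ℝ) + dPar n ε) / 2 := by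
    exact hs
  set m := n / 2 with hm
  have hsu : (s : ℝ) ≤ u + 2 := by linarith
  have hs0 : (0 : ℝ) ≤ s := Nat.cast_nonneg s
  have hms : (n : ℝ) / 2 - u - 5 / 2 ≤ (m : ℝ) - s := by linarith
  have hms0 : 0 < (m : ℝ) - s := by linarith
  have hlt : s < n / 2 := by
    have : (s : ℝ) < m := by linarith
    exact_mod_cast this
  have hdec := choose_decay n s hlt s le_rfl
  have hfrac : (s : ℝ) ^ 2 / ((m : ℝ) - s) ≤ 4 * L + 1200 := by
    rw [div_le_iff₀ hms0]
    have h3 : (s : ℝ) ^ 2 ≤ (u + 2) ^ 2 := by gcongr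
    have h4 : (4 * L + 1200) * ((n : ℝ) / 2 - u - 5 / 2) ≤ (4 * L + 1200) * ((m : ℝ) - s) := by
      gcongr
    nlinarith
  refine le_trans ?_ hdec
  have h5 : Real.exp (-1200) / 100 ^ 4 * ε ^ 4 = Real.exp (-(4 * L + 1200)) := by
    rw [neg_add, Real.exp_add, hexpL]; ring
  rw [h5, mul_comm]
  have h6 : Real.exp (-(4 * L + 1200)) ≤ Real.exp (-((s : ℝ) ^ 2 / ((m : ℝ) - s))) :=
    Real.exp_le_exp.mpr (by linarith)
  exact mul_le_mul_of_nonneg_left h6 (Nat.cast_nonneg _)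

lemma ratio_bound : ∃ c : ℝ, 0 < c ∧ ∀ n : ℕ, 1 ≤ n → ∀ ε : ℝ, 1 / (n : ℝ) ≤ ε → ε ≤ 1 / 2 →
    ∀ a b : ℕ, a ≤ b → b ≤ n → (b : ℝ) ≤ ((n : ℝ) + dPar n ε) / 2 →
      c * ε ^ 4 * (n.choose a : ℝ) ≤ n.choose b := by
  obtain ⟨N, hN⟩ : ∃ N : ℕ, N = 100000 := ⟨_, rfl⟩
  have he1 : Real.exp (-1200) / 100 ^ 4 ≤ 1 := by
    have : Real.exp (-1200) ≤ 1 := Real.exp_le_one_iff.mpr (by norm_num)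
    rw [div_le_iff₀ (by norm_num)]; linarith
  have he0 : 0 < Real.exp (-1200) / 100 ^ 4 := by positivity
  have hp0 : (0 : ℝ) < (1 / 2) ^ N := by positivity
  have hp1 : (1 / 2 : ℝ) ^ N ≤ 1 := pow_le_one₀ (by norm_num) (by norm_num)
  refine ⟨Real.exp (-1200) / 100 ^ 4 * (1 / 2) ^ N, by positivity, ?_⟩
  intro n hn ε h1 h2 a b hab hbn hb
  have hn0 : (0 : ℝ) < n := by exact_mod_cast hn
  have hε : 0 < ε := lt_of_lt_of_le (by positivity) h1
  have hε4 : ε ^ 4 ≤ 1 := pow_le_one₀ hε.le (by linarith)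
  have hε40 : 0 < ε ^ 4 := by positivity
  have hbig := big_case n
  generalize Real.exp (-1200) / 100 ^ 4 = e at *
  have hca : (0 : ℝ) ≤ n.choose a := Nat.cast_nonneg _
  have hc1 : e * (1 / 2) ^ N ≤ 1 := mul_le_one₀ he1 hp0.le hp1
  rcases le_or_gt b (n / 2) with hbm | hbm
  · have h3 : (n.choose a : ℝ) ≤ n.choose b := by
      exact_mod_cast choose_mono_half n a b hab hbm
    have h4 : e * (1 / 2) ^ N * ε ^ 4 ≤ 1 := mul_le_one₀ hc1 hε40.le hε4
    nlinarith
  · rcases le_or_gt N n with hNn | hNn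
    · obtain ⟨s, rfl⟩ : ∃ s, b = n / 2 + s := ⟨b - n / 2, by omega⟩
      refine le_trans ?_ (hbig (by omega) ε h1 h2 s hb)
      have h3 : (n.choose a : ℝ) ≤ n.choose (n / 2) := by
        exact_mod_cast Nat.choose_le_middle a n
      have h4 : e * (1 / 2) ^ N ≤ e := by nlinarith
      gcongr
    · have h3 : (n.choose a : ℝ) ≤ 2 ^ N := by
        have h5 : n.choose a ≤ 2 ^ n := Nat.choose_le_two_pow n a
        have h6 : (n.choose a : ℝ) ≤ 2 ^ n := by exact_mod_cast h5
        exact h6.trans (pow_le_pow_right₀ (by norm_num) hNn.le)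
      have h4 : (1 : ℝ) ≤ n.choose b := by
        exact_mod_cast Nat.choose_pos hbn
      have h5 : (1 / 2 : ℝ) ^ N * 2 ^ N = 1 := by rw [← mul_pow]; norm_num
      refine le_trans ?_ h4
      calc e * (1 / 2) ^ N * ε ^ 4 * (n.choose a : ℝ)
          ≤ 1 * (1 / 2) ^ N * 1 * 2 ^ N := by gcongr
        _ = 1 := by rw [one_mul, mul_one, h5]

lemma wt_add {n : ℕ} (x y : Fin n → Bool) (h : ∀ i, y i ≤ x i) :
    wt x = wt y + hamm y x := by
  unfold wt hamm
  rw [← Finset.card_union_of_disjoint]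
  · congr 1
    ext i
    have := h i
    simp only [Finset.mem_filter, Finset.mem_univ, true_and, Finset.mem_union]
    revert this
    cases x i <;> cases y i <;> simp
  · rw [Finset.disjoint_left]
    intro i
    have := h i
    simp only [Finset.mem_filter, Finset.mem_univ, true_and]
    revert this
    cases x i <;> cases y i <;> simp

lemma wt_le {n : ℕ} (x : Fin n → Bool) : wt x ≤ n := by
  unfold wt
  exact (Finset.card_filter_le _ _).trans (by simp)

lemma densDown_zero {n : ℕ} (x : Fin n → Bool) (A : Finset (Fin n → Bool)) (hx : x ∈ A) :
    1 ≤ densDown x A 0 := by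
  classical
  unfold densDown
  simp only [Nat.zero_le, if_true, Nat.choose_zero_right, Nat.cast_one, div_one]
  have : 0 < (A.filter (fun y => (∀ i, y i ≤ x i) ∧ hamm y x = 0)).card := by
    apply Finset.card_pos.mpr
    exact ⟨x, by simp [hx, hamm]⟩
  convert (show (1 : ℝ) ≤ (A.filter (fun y => (∀ i, y i ≤ x i) ∧ hamm y x = 0)).card by
    exact_mod_cast this)

lemma densDown_eq {n : ℕ} (x : Fin n → Bool) (A : Finset (Fin n → Bool)) (k : ℕ) :
    densDown x A k = ∑ y ∈ A, open Classical in
      if (∀ i, y i ≤ x i) ∧ hamm y x = k then 1 / ((wt x).choose k : ℝ) else 0 := by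
  classical
  rw [← Finset.sum_filter, Finset.sum_const, nsmul_eq_mul, mul_one_div]
  unfold densDown
  split_ifs with h
  · congr!
  · rw [Nat.choose_eq_zero_of_lt (by omega)]; simp

lemma densUp_eq {n : ℕ} (x : Fin n → Bool) (A : Finset (Fin n → Bool)) (k : ℕ) :
    densUp x A k = ∑ y ∈ A, open Classical in
      if (∀ i, x i ≤ y i) ∧ hamm x y = k then 1 / ((n - wt x).choose k : ℝ) else 0 := by
  classical
  rw [← Finset.sum_filter, Finset.sum_const, nsmul_eq_mul, mul_one_div]
  unfold densUp
  split_ifs with h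
  · congr!
  · rw [Nat.choose_eq_zero_of_lt (by omega)]; simp

theorem avg_down_score_vs_up_score :
    ∃ c : ℝ, 0 < c ∧ ∀ n : ℕ, 1 ≤ n → ∀ ε : ℝ, 1 / (n : ℝ) ≤ ε → ε ≤ 1 / 2 →
      ∀ A : Finset (Fin n → Bool), A ⊆ Lmid n ε → A.Nonempty →
        1 + c * ε ^ 4 * ((∑ x ∈ A, scoreUp x A) / (A.card : ℝ)) ≤
          (∑ x ∈ A, scoreDown x A) / (A.card : ℝ) := by
  classical
  obtain ⟨c, hc, hratio⟩ := ratio_bound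
  refine ⟨c, hc, ?_⟩
  intro n hn ε h1 h2 A hA hne
  have hcard : (0 : ℝ) < A.card := by exact_mod_cast hne.card_pos
  have hk : ∀ k, c * ε ^ 4 * ∑ x ∈ A, densUp x A k ≤ ∑ x ∈ A, densDown x A k := by
    intro k
    simp only [densDown_eq, densUp_eq]
    rw [Finset.sum_comm (s := A) (t := A)
      (f := fun x y => if (∀ i, y i ≤ x i) ∧ hamm y x = k then 1 / ((wt x).choose k : ℝ) else 0)]
    simp only [Finset.mul_sum]
    refine Finset.sum_le_sum fun y hy => Finset.sum_le_sum fun x hx => ?_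
    split_ifs with h
    · obtain ⟨hle, hk⟩ := h
      have hw := wt_add x y hle
      rw [hk] at hw
      have hxn := wt_le x
      have hxm := hA hx
      simp only [Lmid, Finset.mem_filter, Finset.mem_univ, true_and] at hxm
      have hr := hratio n hn ε h1 h2 (wt y) (wt x) (by omega) hxn hxm.2
      have hch : n.choose (wt x) * (wt x).choose (wt y)
          = n.choose (wt y) * (n - wt y).choose (wt x - wt y) :=
        Nat.choose_mul (by omega)
      have hsub : wt x - wt y = k := by omega
      have hsym : (wt x).choose (wt y) = (wt x).choose k := by
        rw [hw]; exact Nat.choose_symm_add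
      rw [hsub, hsym] at hch
      have hch' : (n.choose (wt x) : ℝ) * (wt x).choose k
          = n.choose (wt y) * (n - wt y).choose k := by exact_mod_cast hch
      have p1 : (0 : ℝ) < (wt x).choose k := by exact_mod_cast Nat.choose_pos (by omega)
      have p2 : (0 : ℝ) < (n - wt y).choose k := by exact_mod_cast Nat.choose_pos (by omega)
      have p3 : (0 : ℝ) < n.choose (wt y) := by exact_mod_cast Nat.choose_pos (by omega)
      rw [mul_one_div, div_le_div_iff₀ p2 p1, one_mul]
      refine le_of_mul_le_mul_left ?_ p3
      rw [← hch']
      calc _ = c * ε ^ 4 * (n.choose (wt y) : ℝ) * (wt x).choose k := by ring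
        _ ≤ _ := by gcongr
    · simp
  have h0 : (A.card : ℝ) ≤ ∑ x ∈ A, densDown x A 0 := by
    have := Finset.card_nsmul_le_sum A (fun x => densDown x A 0) 1
      (fun x hx => densDown_zero x A hx)
    simpa using this
  have hsumD : ∑ x ∈ A, scoreDown x A
      = ∑ x ∈ A, densDown x A 0 + ∑ k ∈ Finset.Icc 1 n, ∑ x ∈ A, densDown x A k := by
    unfold scoreDown
    rw [Finset.sum_comm, Finset.range_eq_Ico, Finset.sum_eq_sum_Ico_succ_bot (by omega)]
    rfl
  have hsumU : ∑ x ∈ A, scoreUp x A = ∑ k ∈ Finset.Icc 1 n, ∑ x ∈ A, densUp x A k := by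
    unfold scoreUp
    rw [Finset.sum_comm]
  have hall : c * ε ^ 4 * ∑ x ∈ A, scoreUp x A
      ≤ ∑ k ∈ Finset.Icc 1 n, ∑ x ∈ A, densDown x A k := by
    rw [hsumU, Finset.mul_sum]
    exact Finset.sum_le_sum fun k _ => hk k
  rw [le_div_iff₀ hcard, add_mul, one_mul, mul_assoc, div_mul_cancel₀ _ hcard.ne', hsumD]
  linarith
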